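/- arXiv:2407.10232 — 2 statements merged into one kernel-verified Lean document; each statement's English description precedes it below -/
import Mathlib

section
/- Let n ≥ 2 and let D be a division ring. The n × n matrix ring Mₙ(D) is a GWNC ring if and only if either D is isomorphic to the field ℤ/2ℤ, or D is isomorphic to the field ℤ/3ℤ and n = 2. -/
def IsWeaklyNilCleanElem {R : Type*} [Ring R] (a : R) : Prop :=
  ∃ e q : R, IsIdempotentElem e ∧ IsNilpotent q ∧ (a = q + e ∨ a = q - e)

def IsGWNCRing (R : Type*) [Ring R] : Prop :=
  ∀ a : R, ¬IsUnit a → IsWeaklyNilCleanElem a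


/-- Ring homomorphisms preserve weakly nil-clean elements. -/
theorem IsWeaklyNilCleanElem.map {R S : Type*} [Ring R] [Ring S] (f : R →+* S) {a : R}
    (h : IsWeaklyNilCleanElem a) : IsWeaklyNilCleanElem (f a) := by
  obtain ⟨e, q, he, hq, h⟩ := h
  refine ⟨f e, f q, he.map f, hq.map f, ?_⟩
  rcases h with rfl | rfl <;> simp

theorem IsGWNCRing.of_ringEquiv {R S : Type*} [Ring R] [Ring S] (f : R ≃+* S)
    (h : IsGWNCRing R) : IsGWNCRing S := by
  intro a ha
  have := (h (f.symm a) (by rwa [isUnit_map_iff])).map f.toRingHom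
  simpa using this

/-- A submodule contained in its image under a nilpotent endomorphism is zero. -/
theorem Submodule.eq_bot_of_le_map_of_isNilpotent {R M : Type*} [Ring R] [AddCommGroup M]
    [Module R M] {q : Module.End R M} (hq : IsNilpotent q) {S : Submodule R M}
    (hS : S ≤ S.map q) : S = ⊥ := by
  obtain ⟨k, hk⟩ := hq
  have h : ∀ j : ℕ, S ≤ S.map (q ^ j) := by
    intro j
    induction j with
    | zero => simp [Module.End.one_eq_id]
    | succ j ih =>
      rw [pow_succ, Module.End.mul_eq_comp, Submodule.map_comp]
      exact ih.trans (Submodule.map_mono hS)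
  have := h k
  rw [hk] at this
  simpa using this

/-- If `x ↦ φ x • u` is nil-clean, then `φ u` is `0` or `1`. -/
theorem LinearMap.apply_eq_zero_or_one_of_smul_eq_add {D V : Type*} [DivisionRing D]
    [AddCommGroup V] [Module D V] (φ : V →ₗ[D] D) (u : V) {e q : Module.End D V}
    (he : IsIdempotentElem e) (hq : IsNilpotent q) (h : ∀ x, φ x • u = q x + e x) :
    φ u = 0 ∨ φ u = 1 := by
  have hee : ∀ x, e (e x) = e x := fun x => LinearMap.congr_fun he x
  have hq0 : ∀ (x : V) (c : D), q x = c • x → c ≠ 0 → x = 0 := by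
    intro x c hx hc
    have : D ∙ x = ⊥ := Submodule.eq_bot_of_le_map_of_isNilpotent hq <| by
      rw [Submodule.span_singleton_le_iff_mem]
      exact ⟨c⁻¹ • x, Submodule.smul_mem _ _ (Submodule.mem_span_singleton_self x), by
        rw [map_smul, hx, inv_smul_smul₀ hc]⟩
    simpa using this
  have hinj : ∀ x, φ (e x) = 0 → e x = 0 := by
    intro x hx
    apply hq0 (e x) (-1) _ (by simp)
    have := h (e x)
    rw [hx, zero_smul, hee] at this
    rw [neg_one_smul]
    exact eq_neg_of_add_eq_zero_left this.symm
  by_cases hz : ∀ x, e x = 0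
  · by_contra! hne
    have := hq0 u (φ u) (by rw [h u, hz, add_zero]) hne.1
    exact hne.1 (by rw [this, map_zero])
  push Not at hz
  obtain ⟨w₀, hw₀⟩ := hz
  have hφ : φ (e w₀) ≠ 0 := fun h0 => hw₀ (hinj _ h0)
  obtain ⟨v, hev, hφv⟩ : ∃ v, e v = v ∧ φ v = 1 :=
    ⟨(φ (e w₀))⁻¹ • e w₀, by rw [map_smul, hee], by
      rw [map_smul, smul_eq_mul, inv_mul_cancel₀ hφ]⟩
  have heu : e u = φ (e u) • v := by
    have h1 : e (u - φ (e u) • v) = 0 := hinj _ (by simp [hev, hφv])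
    rw [map_sub, map_smul, hev, sub_eq_zero] at h1
    exact h1
  have hqv : q v = u - v := by
    have := h v
    rw [hφv, one_smul, hev] at this
    rw [this, add_sub_cancel_right]
  have hqu : q u = φ u • u - φ (e u) • v := by
    rw [← heu, h u, add_sub_cancel_right]
  have hqw : q (u - v) = (φ u - 1) • (u - v) + (φ u - φ (e u)) • v := by
    rw [map_sub, hqu, hqv, smul_sub, sub_smul, sub_smul, sub_smul, one_smul, one_smul]
    abel
  by_cases hs : φ u - φ (e u) = 0
  · right
    rw [hs, zero_smul, add_zero] at hqw
    by_contra hne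
    have := hq0 _ _ hqw (sub_ne_zero.mpr hne)
    rw [sub_eq_zero] at this
    exact hne (this ▸ hφv)
  · exfalso
    have hS : Submodule.span D {v, u - v} = ⊥ :=
      Submodule.eq_bot_of_le_map_of_isNilpotent hq <| by
        have hv : v ∈ Submodule.span D {v, u - v} := Submodule.subset_span (by simp)
        have hw : u - v ∈ Submodule.span D {v, u - v} := Submodule.subset_span (by simp)
        rw [Submodule.span_le]
        rintro x (rfl | rfl)
        · refine ⟨(φ u - φ (e u))⁻¹ • ((u - x) - (φ u - 1) • x),
            Submodule.smul_mem _ _ (Submodule.sub_mem _ hw (Submodule.smul_mem _ _ hv)), ?_⟩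
          rw [map_smul, map_sub, hqw, map_smul, hqv, add_sub_cancel_left, inv_smul_smul₀ hs]
        · exact ⟨v, hv, hqv⟩
    have : v = 0 := by
      have hv : v ∈ Submodule.span D {v, u - v} := Submodule.subset_span (by simp)
      rwa [hS, Submodule.mem_bot] at hv
    rw [this, map_zero] at hφv
    exact zero_ne_one hφv

/-- A division ring with elements `0, 1, -1` only is `ℤ/2ℤ` or `ℤ/3ℤ`. -/
theorem DivisionRing.nonempty_ringEquiv_zmod_of_forall {D : Type*} [DivisionRing D]
    (h : ∀ d : D, d = 0 ∨ d = 1 ∨ d = -1) :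
    Nonempty (D ≃+* ZMod 2) ∨ Nonempty (D ≃+* ZMod 3) := by
  have key : ∀ p : ℕ, p.Prime → (p : D) = 0 → Nonempty (D ≃+* ZMod p) := by
    intro p hp hp0
    have : CharP D p := (CharP.charP_iff_prime_eq_zero hp).mpr hp0
    refine ⟨(RingEquiv.ofBijective (ZMod.castHom (dvd_refl p) D)
      ⟨ZMod.castHom_injective D, fun d => ?_⟩).symm⟩
    rcases h d with rfl | rfl | rfl
    · exact ⟨0, map_zero _⟩
    · exact ⟨1, map_one _⟩
    · exact ⟨-1, by rw [map_neg, map_one]⟩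
  rcases h (1 + 1) with h2 | h2 | h2
  · exact .inl (key 2 Nat.prime_two (by exact_mod_cast h2))
  · simp at h2
  · refine .inr (key 3 Nat.prime_three ?_)
    have h3 : (1 + 1 + 1 : D) = 0 := by rw [h2, neg_add_cancel]
    exact_mod_cast h3

/-- A nilpotent matrix acts nilpotently on row vectors. -/
theorem Matrix.isNilpotent_toLinearMapRight' {D ι : Type*} [Ring D] [Fintype ι] [DecidableEq ι]
    {M : Matrix ι ι D} (hM : IsNilpotent M) :
    IsNilpotent (M.toLinearMapRight' : Module.End D (ι → D)) := by
  obtain ⟨k, hk⟩ := hM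
  have h : ∀ j : ℕ,
      (M.toLinearMapRight' : Module.End D (ι → D)) ^ j = (M ^ j).toLinearMapRight' := by
    intro j
    induction j with
    | zero => simp [Module.End.one_eq_id]
    | succ j ih => rw [pow_succ, ih, pow_succ', Matrix.toLinearMapRight'_mul]; rfl
  exact ⟨k, by rw [h, hk, map_zero]⟩

theorem Matrix.eq_zero_or_one_of_single_eq_add {D ι : Type*} [DivisionRing D] [Fintype ι]
    [DecidableEq ι] (i : ι) {d : D} {e q : Matrix ι ι D} (he : IsIdempotentElem e)
    (hq : IsNilpotent q) (h : Matrix.single i i d = q + e) : d = 0 ∨ d = 1 := by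
  have := LinearMap.apply_eq_zero_or_one_of_smul_eq_add
    (LinearMap.proj i : (ι → D) →ₗ[D] D) (Pi.single i d)
    (e := e.toLinearMapRight') (q := q.toLinearMapRight')
    ((Matrix.toLinearMapRight'_mul e e).symm.trans (by rw [he.eq]))
    (Matrix.isNilpotent_toLinearMapRight' hq) (fun x => by
      rw [Matrix.toLinearMapRight'_apply, Matrix.toLinearMapRight'_apply, ← Matrix.vecMul_add, ← h]
      ext j
      by_cases hj : j = i
      · subst hj; simp [Matrix.vecMul, dotProduct, Matrix.single_apply]
      · simp [Matrix.vecMul, dotProduct, hj, Ne.symm hj])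
  simpa using this

theorem Matrix.not_isUnit_of_row_eq_zero {D ι : Type*} [Ring D] [Nontrivial D] [Fintype ι]
    [DecidableEq ι] {M : Matrix ι ι D} (i : ι) (h : ∀ j, M i j = 0) : ¬IsUnit M := by
  rintro hM
  obtain ⟨N, hN⟩ := hM.exists_right_inv
  have := congrFun (congrFun hN i) i
  simp [Matrix.mul_apply, h] at this

theorem IsGWNCRing.eq_zero_or_one_or_neg_one {D : Type*} [DivisionRing D] {n : ℕ} (hn : 2 ≤ n)
    (h : IsGWNCRing (Matrix (Fin n) (Fin n) D)) (d : D) : d = 0 ∨ d = 1 ∨ d = -1 := by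
  have hu : ¬IsUnit (Matrix.single (⟨0, by omega⟩ : Fin n) (⟨0, by omega⟩ : Fin n) d) :=
    Matrix.not_isUnit_of_row_eq_zero ⟨1, by omega⟩ fun j => by simp
  obtain ⟨e, q, he, hq, h | h⟩ := h _ hu
  · have := Matrix.eq_zero_or_one_of_single_eq_add _ he hq h
    tauto
  · have := Matrix.eq_zero_or_one_of_single_eq_add ⟨0, by omega⟩ (d := -d) he hq.neg
      (by rw [← Matrix.single_neg, h, neg_sub', sub_neg_eq_add])
    rw [neg_eq_zero, neg_eq_iff_eq_neg] at this
    tauto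

/-- Over a field, the rank of the idempotent in a nil-clean decomposition of `a` is at most the
rank of `a`. -/
theorem Matrix.rank_le_of_eq_add {K ι : Type*} [Field K] [Fintype ι] [DecidableEq ι]
    {a e q : Matrix ι ι K} (he : IsIdempotentElem e) (hq : IsNilpotent q) (h : a = q + e) :
    e.rank ≤ a.rank := by
  obtain ⟨u, hu⟩ := hq.isUnit_one_add
  have h1 : e = (↑u⁻¹ : Matrix ι ι K) * (a * e) := by
    rw [Units.eq_inv_mul_iff_mul_eq, hu, h, add_mul, add_mul, one_mul, he.eq, add_comm]
  calc e.rank ≤ (a * e).rank := by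
        conv_lhs => rw [h1]
        exact Matrix.rank_mul_le_right _ _
    _ ≤ a.rank := Matrix.rank_mul_le_left _ _

theorem Matrix.trace_eq_rank_of_isIdempotentElem {K ι : Type*} [Field K] [Fintype ι]
    [DecidableEq ι] {e : Matrix ι ι K} (he : IsIdempotentElem e) : e.trace = e.rank := by
  have h := (LinearMap.IsIdempotentElem.isProj_range _
    (he.map (Matrix.toLinAlgEquiv' (R := K) (n := ι)))).trace
  rw [Matrix.rank, ← Matrix.toLin'_apply', ← Matrix.trace_toLin'_eq]
  exact h

theorem Matrix.isNilpotent_of_nilClean_zmod_three {ι : Type*} [Fintype ι] [DecidableEq ι]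
    {a e q : Matrix ι ι (ZMod 3)} (htr : a.trace = 0) (hrank : a.rank ≤ 2)
    (he : IsIdempotentElem e) (hq : IsNilpotent q) (h : a = q + e) : IsNilpotent a := by
  have : Fact (Nat.Prime 3) := ⟨Nat.prime_three⟩
  have hle := (Matrix.rank_le_of_eq_add he hq h).trans hrank
  have hqtr := (Matrix.isNilpotent_trace_of_isNilpotent hq).eq_zero
  have hetr : (e.rank : ZMod 3) = 0 := by
    rw [← Matrix.trace_eq_rank_of_isIdempotentElem he, ← htr, h, Matrix.trace_add, hqtr, zero_add]
  have h0 : e.rank = 0 :=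
    Nat.eq_zero_of_dvd_of_lt ((ZMod.natCast_eq_zero_iff _ _).mp hetr) (by omega)
  have he0 : e = 0 := by
    rw [Matrix.rank, Submodule.finrank_eq_zero, LinearMap.range_eq_bot] at h0
    rwa [← Matrix.toLin'_apply', map_eq_zero_iff _ (LinearEquiv.injective _)] at h0
  rwa [h, he0, add_zero]

theorem Matrix.not_isGWNCRing_zmod_three {n : ℕ} (hn : 3 ≤ n) :
    ¬IsGWNCRing (Matrix (Fin n) (Fin n) (ZMod 3)) := by
  have : Fact (Nat.Prime 3) := ⟨Nat.prime_three⟩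
  intro hG
  let i₀ : Fin n := ⟨0, by omega⟩
  let i₁ : Fin n := ⟨1, by omega⟩
  let i₂ : Fin n := ⟨2, by omega⟩
  have h01 : i₀ ≠ i₁ := by simp [i₀, i₁]
  have h20 : i₂ ≠ i₀ := by simp [i₀, i₂]
  have h21 : i₂ ≠ i₁ := by simp [i₁, i₂]
  let w : Fin n → ZMod 3 := Pi.single i₀ 1 - Pi.single i₁ 1
  have htr : (Matrix.diagonal w).trace = 0 := by simp [w, Matrix.trace_diagonal]
  have hnil : ¬IsNilpotent (Matrix.diagonal w) := by
    rintro ⟨k, hk⟩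
    rw [Matrix.diagonal_pow] at hk
    have := congrFun (congrFun hk i₀) i₀
    simp [w, h01] at this
  have hrank : (Matrix.diagonal w).rank ≤ 2 := by
    rw [Matrix.rank_diagonal, Fintype.card_subtype]
    refine (Finset.card_le_card (t := {i₀, i₁}) fun i hi => ?_).trans Finset.card_le_two
    by_contra hne
    simp only [Finset.mem_insert, Finset.mem_singleton, not_or] at hne
    simp [w, hne.1, hne.2] at hi
  have hu : ¬IsUnit (Matrix.diagonal w) :=
    Matrix.not_isUnit_of_row_eq_zero i₂ fun j => by
      by_cases hj : i₂ = j
      · subst hj; simp [w, h20, h21]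
      · exact Matrix.diagonal_apply_ne _ hj
  obtain ⟨e, q, he, hq, h | h⟩ := hG _ hu
  · exact hnil (Matrix.isNilpotent_of_nilClean_zmod_three htr hrank he hq h)
  · refine hnil (isNilpotent_neg_iff.mp
      (Matrix.isNilpotent_of_nilClean_zmod_three (e := e) (q := -q) ?_ ?_ he hq.neg ?_))
    · rw [Matrix.trace_neg, htr, neg_zero]
    · rw [← neg_one_mul]
      exact (Matrix.rank_mul_le_right _ _).trans hrank
    · rw [h, neg_sub', sub_neg_eq_add]

theorem Matrix.isGWNCRing_two_zmod_three : IsGWNCRing (Matrix (Fin 2) (Fin 2) (ZMod 3)) := by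
  intro a ha
  have hdet : a.det = 0 := by
    by_contra h
    exact ha ((Matrix.isUnit_iff_isUnit_det a).mpr (isUnit_iff_ne_zero.mpr h))
  have hsq : a * a = a.trace • a := by
    rw [Matrix.det_fin_two] at hdet
    ext i j
    fin_cases i <;> fin_cases j <;> simp [Matrix.mul_apply, Fin.sum_univ_two, Matrix.trace_fin_two] <;>
      grind
  have hcases : ∀ t : ZMod 3, t = 0 ∨ t = 1 ∨ t = -1 := by decide
  rcases hcases a.trace with ht | ht | ht <;> rw [ht] at hsq
  · exact ⟨0, a, .zero, ⟨2, by rw [pow_two, hsq, zero_smul]⟩, .inl (add_zero a).symm⟩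
  · exact ⟨a, 0, by rw [IsIdempotentElem, hsq, one_smul], .zero, .inl (zero_add a).symm⟩
  · exact ⟨-a, 0, by rw [IsIdempotentElem, neg_mul_neg, hsq, neg_one_smul], .zero, .inr (by simp)⟩

/-- An endomorphism is nilpotent if one of its powers maps into a subspace killed by another
power. -/
theorem Module.End.isNilpotent_of_forall_mem {R M : Type*} [Ring R] [AddCommGroup M] [Module R M]
    {q : Module.End R M} (S : Submodule R M) {k l : ℕ} (hk : ∀ x, (q ^ k) x ∈ S)
    (hl : ∀ x ∈ S, (q ^ l) x = 0) : IsNilpotent q :=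
  ⟨l + k, LinearMap.ext fun x => by
    rw [pow_add, Module.End.mul_apply, hl _ (hk x), LinearMap.zero_apply]⟩

/-- An element which is the sum of an idempotent and a nilpotent. -/
def IsNilCleanElem {R : Type*} [Ring R] (a : R) : Prop :=
  ∃ e q : R, IsIdempotentElem e ∧ IsNilpotent q ∧ a = q + e

theorem IsNilCleanElem.isWeaklyNilCleanElem {R : Type*} [Ring R] {a : R}
    (h : IsNilCleanElem a) : IsWeaklyNilCleanElem a :=
  let ⟨e, q, he, hq, h⟩ := h
  ⟨e, q, he, hq, .inl h⟩

/-- Nil-cleanness of an endomorphism can be checked on an invariant subspace and the quotient. -/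
theorem Module.End.isNilCleanElem_of_restrict_of_mapQ {K V : Type*} [Field K] [AddCommGroup V]
    [Module K V] {a : Module.End K V} (S : Submodule K V) (hS : S ≤ S.comap a)
    (h₁ : IsNilCleanElem (a.restrict hS : Module.End K S))
    (h₂ : IsNilCleanElem (S.mapQ S a hS : Module.End K (V ⧸ S))) : IsNilCleanElem a := by
  obtain ⟨e₁, q₁, he₁, ⟨l, hl⟩, h₁⟩ := h₁
  obtain ⟨e₂, q₂, he₂, ⟨k, hk⟩, h₂⟩ := h₂
  obtain ⟨T, hT⟩ := S.exists_isCompl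
  let p : V →ₗ[K] S := S.projectionOnto T hT
  let s : V ⧸ S →ₗ[K] V := T.subtype ∘ₗ (S.quotientEquivOfIsCompl T hT).toLinearMap
  have hpS : ∀ x : S, p x = x := fun x => Submodule.projectionOnto_apply_left hT x
  have hps : ∀ y, p (s y) = 0 := fun y => Submodule.projectionOnto_apply_right hT _
  have hms : ∀ y, S.mkQ (s y) = y := fun y => by
    obtain ⟨t, rfl⟩ := (S.quotientEquivOfIsCompl T hT).symm.surjective y
    change S.mkQ (S.quotientEquivOfIsCompl T hT ((S.quotientEquivOfIsCompl T hT).symm t)) = _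
    rw [LinearEquiv.apply_symm_apply, Submodule.quotientEquivOfIsCompl_symm_apply,
      Submodule.mkQ_apply]
  have hmS : ∀ x : S, S.mkQ x = 0 := fun x => by simp
  let e : Module.End K V := S.subtype ∘ₗ e₁ ∘ₗ p + s ∘ₗ e₂ ∘ₗ S.mkQ
  have he : ∀ x, e x = e₁ (p x) + s (e₂ (S.mkQ x)) := fun x => rfl
  have hee₁ : ∀ x, e₁ (e₁ x) = e₁ x := fun x => LinearMap.congr_fun he₁ x
  have hee₂ : ∀ x, e₂ (e₂ x) = e₂ x := fun x => LinearMap.congr_fun he₂ x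
  have hqS : ∀ x : S, (a - e) x = q₁ x := fun x => by
    have : a x = q₁ x + e₁ x := by
      have := congrArg Subtype.val (LinearMap.congr_fun h₁ x)
      simpa using this
    rw [LinearMap.sub_apply, he, hpS, hmS, map_zero, map_zero, add_zero, this, add_sub_cancel_right]
  have hqm : ∀ x, S.mkQ ((a - e) x) = q₂ (S.mkQ x) := fun x => by
    have : S.mkQ (a x) = q₂ (S.mkQ x) + e₂ (S.mkQ x) := LinearMap.congr_fun h₂ (S.mkQ x)
    rw [LinearMap.sub_apply, he, map_sub, map_add, hmS, hms, zero_add, this, add_sub_cancel_right]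
  have hpowS : ∀ (j : ℕ) (x : S), ((a - e) ^ j) x = ((q₁ ^ j) x : S) := fun j => by
    induction j with
    | zero => simp
    | succ j ih => intro x; rw [pow_succ, Module.End.mul_apply, hqS, ih, pow_succ]; rfl
  have hpowm : ∀ (j : ℕ) (x : V), S.mkQ (((a - e) ^ j) x) = (q₂ ^ j) (S.mkQ x) := fun j => by
    induction j with
    | zero => simp
    | succ j ih => intro x; rw [pow_succ, Module.End.mul_apply, ih, hqm, pow_succ]; rfl
  refine ⟨e, a - e, LinearMap.ext fun x => ?_, isNilpotent_of_forall_mem S (k := k) (l := l)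
    (fun x => ?_) (fun x hx => ?_), (sub_add_cancel a e).symm⟩
  · rw [Module.End.mul_apply, he x, map_add, he, he (s _), hpS, hps, hmS, hms, hee₁, hee₂]
    simp
  · rw [← Submodule.ker_mkQ S, LinearMap.mem_ker, hpowm, hk, LinearMap.zero_apply]
  · rw [hpowS l ⟨x, hx⟩, hl]; rfl

/-- An endomorphism is nilpotent if one of its powers kills a basis. -/
theorem Module.End.isNilpotent_of_forall_basis {ι R M : Type*} [Ring R] [AddCommGroup M]
    [Module R M] {q : Module.End R M} (b : Module.Basis ι R M) (k : ℕ)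
    (h : ∀ i, (q ^ k) (b i) = 0) : IsNilpotent q :=
  ⟨k, b.ext fun i => by rw [h, LinearMap.zero_apply]⟩

/-- A cyclic endomorphism over `ℤ/2ℤ` is nil-clean. -/
theorem Module.End.isNilCleanElem_of_cyclic {V : Type*} [AddCommGroup V] [Module (ZMod 2) V]
    {n : ℕ} (a : Module.End (ZMod 2) V) (v : V) (b : Module.Basis (Fin n) (ZMod 2) V)
    (hb : ∀ i : Fin n, b i = (a ^ (i : ℕ)) v) : IsNilCleanElem a := by
  have hsucc : ∀ j : ℕ, a ((a ^ j) v) = (a ^ (j + 1)) v := fun j => by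
    rw [pow_succ', Module.End.mul_apply]
  have hchar : ∀ x : V, x + x = 0 := fun x => by
    rw [← two_smul (ZMod 2) x, show (2 : ZMod 2) = 0 from rfl, zero_smul]
  have hexp : (a ^ n) v = ∑ i, b.repr ((a ^ n) v) i • b i := (b.sum_repr _).symm
  by_cases hc : ∀ i, b.repr ((a ^ n) v) i = 0
  · refine ⟨0, a, .zero, isNilpotent_of_forall_basis b n fun i => ?_, (add_zero a).symm⟩
    rw [hb, ← Module.End.mul_apply, ← pow_add, add_comm, pow_add, Module.End.mul_apply, hexp]
    simp [hc]
  push Not at hc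
  obtain ⟨m, hm0, hmax⟩ : ∃ m, b.repr ((a ^ n) v) m ≠ 0 ∧
      ∀ i, m < i → b.repr ((a ^ n) v) i = 0 := by
    obtain ⟨m, hm, hmax⟩ := (Finset.univ.filter fun i => b.repr ((a ^ n) v) i ≠ 0).exists_max_image
      id (by obtain ⟨i, hi⟩ := hc; exact ⟨i, by simpa using hi⟩)
    refine ⟨m, by simpa using hm, fun i hi => ?_⟩
    by_contra h
    exact absurd (hmax i (by simpa using h)) (not_le.mpr hi)
  have hm1 : b.repr ((a ^ n) v) m = 1 := by
    have : ∀ t : ZMod 2, t ≠ 0 → t = 1 := by decide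
    exact this _ hm0
  clear hm0 hc
  -- the linear form sending `b j` to `1` if `m ≤ j` and to `0` otherwise
  let φ : V →ₗ[ZMod 2] ZMod 2 := b.constr (ZMod 2) fun j => if m ≤ j then 1 else 0
  have hφ : ∀ j, φ (b j) = if m ≤ j then 1 else 0 := fun j => b.constr_basis _ _ j
  have hφn : φ ((a ^ n) v) = 1 := by
    rw [hexp, map_sum, Finset.sum_eq_single m]
    · rw [map_smul, hφ, hm1]; simp
    · intro i _ hi
      rcases lt_or_gt_of_ne hi with h | h
      · rw [map_smul, hφ, if_neg (not_le.mpr h), smul_zero]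
      · rw [hmax i h, zero_smul, map_zero]
    · simp
  obtain ⟨r, rfl⟩ : ∃ r, n = r + 1 := ⟨n - 1, by have := m.isLt; omega⟩
  have hb' : ∀ j (hj : j < r + 1), (a ^ j) v = b ⟨j, hj⟩ := fun j hj => (hb ⟨j, hj⟩).symm
  have hφ' : ∀ j < r + 1, φ ((a ^ j) v) = if (m : ℕ) ≤ j then 1 else 0 := fun j hj => by
    rw [hb' j hj, hφ]; rfl
  by_cases hmr : (m : ℕ) = r
  · let e : Module.End (ZMod 2) V := φ.smulRight ((a ^ (r + 1)) v)
    have he : ∀ x, e x = φ x • (a ^ (r + 1)) v := fun x => rfl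
    refine ⟨e, a - e, LinearMap.ext fun x => ?_, ?_, (sub_add_cancel a e).symm⟩
    · rw [Module.End.mul_apply, he x, map_smul, he, hφn, one_smul]
    have hlow : ∀ j ≤ r, ((a - e) ^ j) v = (a ^ j) v := fun j hj => by
      induction j with
      | zero => rfl
      | succ j ih =>
        rw [pow_succ', Module.End.mul_apply, ih (by omega), LinearMap.sub_apply, hsucc, he,
          hφ' j (by omega), if_neg (by omega), zero_smul, sub_zero]
    have hzero : ((a - e) ^ (r + 1)) v = 0 := by
      rw [pow_succ', Module.End.mul_apply, hlow r le_rfl, LinearMap.sub_apply, hsucc, he,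
        hφ' r (by omega), if_pos hmr.le, one_smul, sub_self]
    refine isNilpotent_of_forall_basis b (r + 1) fun i => ?_
    rw [hb, ← hlow i (by omega), ← Module.End.mul_apply, ← pow_add, add_comm, pow_add,
      Module.End.mul_apply, hzero, map_zero]
  · have hmr' : (m : ℕ) < r := by have := m.isLt; omega
    let ψ : V →ₗ[ZMod 2] ZMod 2 := b.coord (Fin.last r)
    have hψ : ∀ j < r, ψ ((a ^ j) v) = 0 := fun j hj => by
      rw [hb' j (by omega), b.coord_apply, b.repr_self,
        Finsupp.single_eq_of_ne (by simp [Fin.ext_iff]; omega)]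
    have hψr : ψ ((a ^ r) v) = 1 := by
      rw [hb' r (by omega), b.coord_apply, b.repr_self]
      exact Finsupp.single_eq_same
    have hψn : ψ ((a ^ (r + 1)) v) = 0 := hmax _ hmr'
    let c := (a ^ (r + 1)) v + (a ^ r) v
    let e : Module.End (ZMod 2) V := φ.smulRight ((a ^ (m : ℕ)) v) + ψ.smulRight c
    have he : ∀ x, e x = φ x • (a ^ (m : ℕ)) v + ψ x • c := fun x => rfl
    have hem : e ((a ^ (m : ℕ)) v) = (a ^ (m : ℕ)) v := by
      rw [he, hφ' m (by omega), if_pos le_rfl, hψ m hmr', one_smul, zero_smul, add_zero]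
    have hec : e c = c := by
      have h1 : φ c = 0 := by
        rw [map_add, hφn, hφ' r (by omega), if_pos hmr'.le]; rfl
      have h2 : ψ c = 1 := by rw [map_add, hψn, hψr, zero_add]
      rw [he, h1, h2, zero_smul, one_smul, zero_add]
    refine ⟨e, a - e, LinearMap.ext fun x => ?_, ?_, (sub_add_cancel a e).symm⟩
    · rw [Module.End.mul_apply, he x, map_add, map_smul, map_smul, hem, hec]
    have hq₁ : ∀ j < (m : ℕ), (a - e) ((a ^ j) v) = (a ^ (j + 1)) v := fun j hj => by
      rw [LinearMap.sub_apply, hsucc, he, hφ' j (by omega), if_neg (by omega), hψ j (by omega),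
        zero_smul, zero_smul, add_zero, sub_zero]
    have hq₂ : ∀ j, (m : ℕ) ≤ j → j < r →
        (a - e) ((a ^ j) v) = (a ^ (j + 1)) v - (a ^ (m : ℕ)) v := fun j hj hjr => by
      rw [LinearMap.sub_apply, hsucc, he, hφ' j (by omega), if_pos hj, hψ j hjr,
        one_smul, zero_smul, add_zero]
    have hq₃ : (a - e) ((a ^ r) v) = (a ^ r) v - (a ^ (m : ℕ)) v := by
      rw [LinearMap.sub_apply, hsucc, he, hφ' r (by omega), if_pos hmr'.le, hψr,
        one_smul, one_smul, ← sub_eq_zero]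
      calc _ = -((a ^ r) v + (a ^ r) v) := by simp only [c]; abel
        _ = 0 := by rw [hchar, neg_zero]
    have hlow : ∀ j ≤ (m : ℕ), ((a - e) ^ j) v = (a ^ j) v := fun j hj => by
      induction j with
      | zero => rfl
      | succ j ih => rw [pow_succ', Module.End.mul_apply, ih (by omega), hq₁ j (by omega)]
    have hhigh : ∀ i, m + i < r →
        ((a - e) ^ (m + i + 1)) v = (a ^ (m + i + 1)) v - (a ^ (m + i)) v := fun i hi => by
      induction i with
      | zero =>
        rw [add_zero, pow_succ', Module.End.mul_apply, hlow m le_rfl, hq₂ m le_rfl hmr']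
      | succ i ih =>
        rw [pow_succ', Module.End.mul_apply, ← add_assoc, ih (by omega), map_sub,
          hq₂ _ (by omega) (by omega), hq₂ _ (by omega) (by omega), sub_sub_sub_cancel_right]
    have hzero : ((a - e) ^ (r + 1)) v = 0 := by
      obtain ⟨i, hi⟩ : ∃ i, r = m + i + 1 := ⟨r - m - 1, by omega⟩
      have hr := hhigh i (by omega)
      rw [← hi] at hr
      rw [pow_succ', Module.End.mul_apply, hr, map_sub, hq₃, hq₂ (m + i) (by omega) (by omega),
        ← hi, sub_self]
    have hker : ∀ j, ((a - e) ^ (r + 1)) (((a - e) ^ j) v) = 0 := fun j => by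
      rw [← Module.End.mul_apply, ← pow_add, add_comm, pow_add, Module.End.mul_apply, hzero,
        map_zero]
    have hall : ∀ j ≤ r, ((a - e) ^ (r + 1)) ((a ^ j) v) = 0 := fun j hj => by
      induction j with
      | zero => exact hzero
      | succ j ih =>
        rcases Nat.lt_or_ge j m with hjm | hjm
        · rw [← hlow _ hjm, hker]
        · have hcomm : ((a - e) ^ (r + 1)) ((a - e) ((a ^ j) v)) = 0 := by
            rw [← Module.End.mul_apply, ← pow_succ, pow_succ', Module.End.mul_apply,
              ih (by omega), map_zero]
          rwa [hq₂ j hjm hj, map_sub, ← hlow m le_rfl, hker, sub_zero] at hcomm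
    exact isNilpotent_of_forall_basis b (r + 1) fun i => by rw [hb, hall i (by omega)]

/-- Every endomorphism of a finite-dimensional vector space over `ℤ/2ℤ` is nil-clean. -/
theorem Module.End.isNilCleanElem_zmod_two {V : Type*} [AddCommGroup V] [Module (ZMod 2) V]
    [FiniteDimensional (ZMod 2) V] (a : Module.End (ZMod 2) V) : IsNilCleanElem a := by
  induction hd : Module.finrank (ZMod 2) V using Nat.strong_induction_on generalizing V with
  | _ d ih =>
  subst hd
  by_cases hV : ∀ v : V, v = 0
  · exact ⟨0, 0, .zero, .zero, LinearMap.ext fun x => by simp [hV (a x)]⟩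
  push Not at hV
  obtain ⟨v, hv⟩ := hV
  obtain ⟨n, hn, hn'⟩ : ∃ n : ℕ, LinearIndependent (ZMod 2) (fun i : Fin n => (a ^ (i : ℕ)) v) ∧
      ¬LinearIndependent (ZMod 2) (fun i : Fin (n + 1) => (a ^ (i : ℕ)) v) := by
    by_contra! h
    have hall : ∀ n : ℕ, LinearIndependent (ZMod 2) (fun i : Fin n => (a ^ (i : ℕ)) v) := by
      intro n
      induction n with
      | zero => exact linearIndependent_empty_type
      | succ n ihn => exact h n ihn
    have := (hall (Module.finrank (ZMod 2) V + 1)).fintype_card_le_finrank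
    simp at this
  let S := Submodule.span (ZMod 2) (Set.range fun i : Fin n => (a ^ (i : ℕ)) v)
  have hnS : (a ^ n) v ∈ S := by
    rw [linearIndependent_finSucc'] at hn'
    by_contra h
    exact hn' ⟨hn, h⟩
  have hmem : ∀ i < n, (a ^ i) v ∈ S := fun i hi => Submodule.subset_span ⟨⟨i, hi⟩, rfl⟩
  have hS : S ≤ S.comap a := by
    rw [Submodule.span_le]
    rintro _ ⟨i, rfl⟩
    change a ((a ^ (i : ℕ)) v) ∈ S
    rw [← Module.End.mul_apply, ← pow_succ']
    rcases Nat.lt_or_ge (i + 1) n with h | h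
    · exact hmem _ h
    · rwa [show (i : ℕ) + 1 = n by omega]
  have hn0 : 0 < n := by
    rw [Nat.pos_iff_ne_zero]
    rintro rfl
    simp [S] at hnS
    exact hv hnS
  have hvS : v ∈ S := hmem 0 hn0
  refine isNilCleanElem_of_restrict_of_mapQ S hS ?_ (ih _ ?_ _ rfl)
  · refine isNilCleanElem_of_cyclic _ ⟨v, hvS⟩ (Module.Basis.span hn) fun i => Subtype.ext ?_
    rw [Module.Basis.span_apply, Module.End.pow_restrict]
    rfl
  · have h1 := S.finrank_quotient_add_finrank
    have : Nontrivial S := ⟨⟨⟨v, hvS⟩, 0, fun h => hv (congrArg Subtype.val h)⟩⟩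
    have h2 : 0 < Module.finrank (ZMod 2) S := Module.finrank_pos
    omega

theorem Matrix.isGWNCRing_zmod_two (ι : Type*) [Fintype ι] [DecidableEq ι] :
    IsGWNCRing (Matrix ι ι (ZMod 2)) := by
  have h : IsGWNCRing (Module.End (ZMod 2) (ι → ZMod 2)) := fun a _ =>
    (Module.End.isNilCleanElem_zmod_two a).isWeaklyNilCleanElem
  exact h.of_ringEquiv (Matrix.toLinAlgEquiv' (R := ZMod 2) (n := ι)).symm.toRingEquiv

theorem matrix_divisionRing_isGWNC_iff {n : ℕ} (hn : 2 ≤ n) (D : Type*) [DivisionRing D] :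
    IsGWNCRing (Matrix (Fin n) (Fin n) D) ↔
      Nonempty (D ≃+* ZMod 2) ∨ (Nonempty (D ≃+* ZMod 3) ∧ n = 2) := by
  constructor
  · intro h
    rcases DivisionRing.nonempty_ringEquiv_zmod_of_forall (h.eq_zero_or_one_or_neg_one hn) with
      h2 | ⟨⟨f⟩⟩
    · exact .inl h2
    · refine .inr ⟨⟨f⟩, ?_⟩
      by_contra hne
      exact Matrix.not_isGWNCRing_zmod_three (by omega) (h.of_ringEquiv f.mapMatrix)
  · rintro (⟨⟨f⟩⟩ | ⟨⟨f⟩, rfl⟩)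
    · exact (Matrix.isGWNCRing_zmod_two _).of_ringEquiv f.symm.mapMatrix
    · exact Matrix.isGWNCRing_two_zmod_three.of_ringEquiv f.symm.mapMatrix
end

section
/- Let R be a ring in which 2 is not a unit, and let G be a nontrivial abelian group such that the group ring RG is a GWNC ring. Then 2 is a nilpotent element of R and G is a 2-group, i.e., every element of G has order a power of 2. -/
/-- If `q * p` and `q * x` are nilpotent, with `p` prime, then some `p`-power of `1 + x` equals `1`
up to elements killed by a power of `q`. -/
lemma exists_pow_mul_one_add_pow_prime_pow_sub_one_eq_zero {A : Type*} [CommRing A] {p : ℕ}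
    (hp : p.Prime) {q x : A} (hqp : IsNilpotent (q * p)) (hqx : IsNilpotent (q * x)) :
    ∃ n N : ℕ, q ^ n * ((1 + x) ^ p ^ N - 1) = 0 := by
  obtain ⟨k, hk⟩ := hqp
  obtain ⟨l, hl⟩ := hqx
  set I : Ideal A := Ideal.torsionOf A A (q ^ (k + l)) with hI
  have hmem (a : A) : Ideal.Quotient.mk I a = 0 ↔ q ^ (k + l) * a = 0 := by
    rw [Ideal.Quotient.eq_zero_iff_mem, hI, Ideal.mem_torsionOf_iff, smul_eq_mul, mul_comm]
  have hp0 : (p : A ⧸ I) ^ k = 0 := by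
    have := (hmem ((p : A) ^ k)).2 (by rw [pow_add, mul_right_comm, ← mul_pow, hk, zero_mul])
    simpa using this
  have hx0 : Ideal.Quotient.mk I x ^ l = 0 := by
    rw [← map_pow, hmem, pow_add, mul_assoc, ← mul_pow, hl, mul_zero]
  obtain ⟨r, hr⟩ := exists_add_pow_prime_pow_eq hp (1 : A ⧸ I) (Ideal.Quotient.mk I x) l
  rw [pow_eq_zero_of_le (Nat.lt_pow_self hp.one_lt).le hx0] at hr
  have hdvd : (p : A ⧸ I) ∣ (1 + Ideal.Quotient.mk I x) ^ p ^ l - 1 :=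
    ⟨Ideal.Quotient.mk I x * r, by rw [hr]; ring⟩
  have hdvd' := dvd_sub_pow_of_dvd_sub hdvd k
  rw [pow_succ, hp0, zero_mul, zero_dvd_iff, ← pow_mul, ← pow_add, one_pow] at hdvd'
  exact ⟨k + l, l + k, (hmem _).1 (by simpa using hdvd')⟩

/-- A central weakly nil-clean element `z` satisfies `z ^ 2 = z` or `z ^ 2 = -z` modulo
nilpotents. -/
lemma IsWeaklyNilCleanElem.isNilpotent_sq_sub_or_sq_add {A : Type*} [Ring A]
    {z : Subring.center A} (hz : IsWeaklyNilCleanElem (z : A)) :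
    IsNilpotent (z ^ 2 - z) ∨ IsNilpotent (z ^ 2 + z) := by
  have hinj : Function.Injective (Subring.center A).subtype := Subtype.val_injective
  rw [← IsNilpotent.map_iff hinj, ← IsNilpotent.map_iff hinj]
  change IsNilpotent ((z : A) ^ 2 - z) ∨ IsNilpotent ((z : A) ^ 2 + z)
  obtain ⟨e, q, he, hq, h⟩ := hz
  have hze : Commute (z : A) e := Subring.mem_center_iff.1 z.2 e |>.symm
  rw [IsIdempotentElem] at he
  rcases h with h | h
  · have hqe : Commute q e := by
      rw [← sub_eq_iff_eq_add.2 h]; exact hze.sub_left (.refl e)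
    left
    have : (z : A) ^ 2 - z = q * (q + 2 * e - 1) := by
      rw [h, sq, mul_add, add_mul, add_mul, he, ← hqe.eq]; noncomm_ring
    rw [this]
    refine Commute.isNilpotent_mul_right ?_ hq
    exact (((Commute.refl q).add_right ((Commute.ofNat_right q 2).mul_right hqe)).sub_right
      (.one_right q))
  · have hqe : Commute q e := by
      rw [← eq_sub_iff_add_eq.1 h]; exact hze.add_left (.refl e)
    right
    have : (z : A) ^ 2 + z = q * (q - 2 * e + 1) := by
      rw [h, sq, mul_sub, sub_mul, sub_mul, he, ← hqe.eq]; noncomm_ring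
    rw [this]
    refine Commute.isNilpotent_mul_right ?_ hq
    exact (((Commute.refl q).sub_right ((Commute.ofNat_right q 2).mul_right hqe)).add_right
      (.one_right q))

namespace MonoidAlgebra

variable (R : Type*) [Ring R] {G : Type*} [CommGroup G]

/-- The embedding of a commutative group into the center of its group ring. -/
noncomputable def ofCenter : G →* Subring.center (MonoidAlgebra R G) where
  toFun g := ⟨single g 1, Subring.mem_center_iff.2 fun x =>
    (single_commute (fun _ => .all _ _) (fun _ => .one_left _) x).symm⟩
  map_one' := rfl
  map_mul' g h := Subtype.ext (by simp)

lemma coe_ofCenter (g : G) : (ofCenter R g : MonoidAlgebra R G) = single g 1 := rfl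

/-- The augmentation map of a group ring. -/
noncomputable def augmentation : MonoidAlgebra R G →+* R :=
  liftNCRingHom (RingHom.id R) 1 fun _ _ => .one_right _

variable {R}

lemma augmentation_ofCenter (g : G) :
    augmentation R (ofCenter R g : MonoidAlgebra R G) = 1 := by
  simp [augmentation, coe_ofCenter]

lemma exists_pow_prime_pow_eq_one {p q : ℕ} (hp : p.Prime) (hq : ¬IsNilpotent (q : R)) {g : G}
    (hqp : IsNilpotent ((q : Subring.center (MonoidAlgebra R G)) * p))
    (hqg : IsNilpotent ((q : Subring.center (MonoidAlgebra R G)) * (ofCenter R g - 1))) :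
    ∃ N : ℕ, g ^ p ^ N = 1 := by
  obtain ⟨n, N, h⟩ := exists_pow_mul_one_add_pow_prime_pow_sub_one_eq_zero hp hqp hqg
  refine ⟨N, ?_⟩
  have hqn : ((q ^ n : ℕ) : R) ≠ 0 := fun h0 => hq ⟨n, by exact_mod_cast h0⟩
  rw [add_sub_cancel, ← map_pow, mul_sub, mul_one, sub_eq_zero] at h
  have h' := congrArg Subtype.val h
  rw [← Nat.cast_pow] at h'
  have h'' : single 1 ((q ^ n : ℕ) : R) * single (g ^ p ^ N) (1 : R)
      = single 1 ((q ^ n : ℕ) : R) := h'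
  rw [single_mul_single, one_mul, mul_one] at h''
  exact (single_left_inj hqn).1 h''

lemma isNilpotent_sq_sub_or_sq_add (h : IsGWNCRing (MonoidAlgebra R G))
    {z : Subring.center (MonoidAlgebra R G)}
    (hz : ¬IsUnit (augmentation R (z : MonoidAlgebra R G))) :
    IsNilpotent (z ^ 2 - z) ∨ IsNilpotent (z ^ 2 + z) :=
  (h z fun hu => hz (hu.map _)).isNilpotent_sq_sub_or_sq_add

end MonoidAlgebra

open MonoidAlgebra in
lemma isNilpotent_two_of_isGWNCRing_monoidAlgebra {R : Type*} [Ring R] (G : Type*) [CommGroup G]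
    [Nontrivial G] (h2 : ¬IsUnit (2 : R)) (h : IsGWNCRing (MonoidAlgebra R G)) :
    IsNilpotent (2 : R) := by
  by_contra hn2
  let Z := Subring.center (MonoidAlgebra R G)
  let δ : Z →+* R := (augmentation R).comp Z.subtype
  have hδ (g : G) : δ (ofCenter R g) = 1 := augmentation_ofCenter g
  have key (z : Z) (hz : ¬IsUnit (δ z)) : z ^ 2 - z ∈ nilradical Z ∨ z ^ 2 + z ∈ nilradical Z :=
    isNilpotent_sq_sub_or_sq_add h hz
  have hn2' : (2 : Z) ∉ nilradical Z := fun h0 =>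
    hn2 (map_ofNat δ 2 ▸ (mem_nilradical.1 h0).map δ)
  have h6 : (6 : Z) ∈ nilradical Z := by
    rcases key 2 (by rwa [map_ofNat δ 2]) with h0 | h0
    · exact absurd (by convert h0 using 1; norm_num) hn2'
    · convert h0 using 1; norm_num
  have h6R : IsNilpotent (6 : R) := map_ofNat δ 6 ▸ (mem_nilradical.1 h6).map δ
  have h3 : ¬IsUnit (3 : R) := by
    rintro ⟨u, hu⟩
    have : (2 : R) = 6 * ↑u⁻¹ := by
      rw [show (6 : R) = 2 * 3 by norm_num, ← hu, mul_assoc, Units.mul_inv, mul_one]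
    exact hn2 (this ▸ Commute.isNilpotent_mul_right (Commute.ofNat_left 6 _) h6R)
  have hn3 : ¬IsNilpotent (3 : R) := fun h0 => h2 <| by
    have := IsNilpotent.isUnit_sub_one h0
    norm_num at this
    exact this
  obtain ⟨g, hg⟩ := exists_ne (1 : G)
  set γ : Z := ofCenter R g with hγ
  set γ' : Z := ofCenter R g⁻¹ with hγ'
  have hγγ : γ * γ' = 1 := by rw [hγ, hγ', ← map_mul, mul_inv_cancel, map_one]
  have h2γ : (2 : Z) * (γ - 1) ∈ nilradical Z := by
    rcases key (2 * γ) (by rwa [map_mul, hγ, hδ, mul_one, map_ofNat δ 2]) with h0 | h0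
    · have h1 : (2 : Z) * (γ + 1) ∈ nilradical Z := by
        have := sub_mem (Ideal.mul_mem_left _ γ h6) (Ideal.mul_mem_left _ γ' h0)
        convert this using 1
        linear_combination (4 * γ - 2) * hγγ
      have h4 : IsNilpotent (δ (2 * (γ + 1))) := IsNilpotent.map h1 δ
      rw [map_mul, map_add, hγ, hδ, map_one, map_ofNat δ 2, one_add_one_eq_two, ← sq] at h4
      exact absurd ((IsNilpotent.pow_iff_pos two_ne_zero).1 h4) hn2
    · have := sub_mem (Ideal.mul_mem_left _ γ h6) (Ideal.mul_mem_left _ γ' h0)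
      convert this using 1
      linear_combination (4 * γ + 2) * hγγ
  have h3γ : (3 : Z) * (γ - 1) ∈ nilradical Z := by
    rcases key (3 * γ) (by rwa [map_mul, hγ, hδ, mul_one, map_ofNat δ 3]) with h0 | h0
    · have := sub_mem (Ideal.mul_mem_left _ γ' h0) (Ideal.mul_mem_left _ γ h6)
      convert this using 1
      linear_combination -(9 * γ - 3) * hγγ
    · have := sub_mem (Ideal.mul_mem_left _ γ' h0) (Ideal.mul_mem_left _ (γ + 1) h6)
      convert this using 1
      linear_combination -(9 * γ + 3) * hγγ
  have h23 : IsNilpotent (((2 : ℕ) : Z) * (3 : ℕ)) := by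
    rw [← Nat.cast_mul]; exact mem_nilradical.1 h6
  obtain ⟨M, hM⟩ := exists_pow_prime_pow_eq_one (R := R) (p := 3) (q := 2) (g := g)
    Nat.prime_three (by simpa using hn2) h23
    (mod_cast mem_nilradical.1 h2γ)
  obtain ⟨N, hN⟩ := exists_pow_prime_pow_eq_one (R := R) (p := 2) (q := 3) (g := g)
    Nat.prime_two (by simpa using hn3) (mul_comm ((2 : ℕ) : Z) (3 : ℕ) ▸ h23)
    (mod_cast mem_nilradical.1 h3γ)
  refine hg (orderOf_eq_one_iff.1 (Nat.eq_one_of_dvd_coprimes ?_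
    (orderOf_dvd_of_pow_eq_one hM) (orderOf_dvd_of_pow_eq_one hN)))
  exact Nat.Coprime.pow _ _ (by norm_num)

open MonoidAlgebra in
theorem groupRing_isGWNC_two_nonunit {R : Type*} [Ring R] (G : Type*) [CommGroup G]
    [Nontrivial G] (h2 : ¬IsUnit (2 : R)) (h : IsGWNCRing (MonoidAlgebra R G)) :
    IsNilpotent (2 : R) ∧ ∀ g : G, ∃ k : ℕ, orderOf g = 2 ^ k := by
  have hn2 := isNilpotent_two_of_isGWNCRing_monoidAlgebra G h2 h
  refine ⟨hn2, fun g => ?_⟩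
  have : Nontrivial R := not_subsingleton_iff_nontrivial.1 fun _ => h2 (isUnit_of_subsingleton _)
  let Z := Subring.center (MonoidAlgebra R G)
  have hn2' : (2 : Z) ∈ nilradical Z := by
    obtain ⟨n, hn⟩ := hn2
    refine ⟨n, Subtype.ext ?_⟩
    have := congrArg (singleOneRingHom (R := R) (M := G)) hn
    rwa [map_pow, map_ofNat, map_zero] at this
  set γ : Z := ofCenter R g with hγ
  set γ' : Z := ofCenter R g⁻¹ with hγ'
  have hγγ : γ * γ' = 1 := by rw [hγ, hγ', ← map_mul, mul_inv_cancel, map_one]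
  have hx : γ - 1 ∈ nilradical Z := by
    have hnu : ¬IsUnit (augmentation R ((γ - 1 : Z) : MonoidAlgebra R G)) := by
      rw [AddSubgroupClass.coe_sub, map_sub, hγ, augmentation_ofCenter, Subring.coe_one, map_one, sub_self]
      exact not_isUnit_zero
    rcases isNilpotent_sq_sub_or_sq_add h hnu with h0 | h0
    · have := add_mem (Ideal.mul_mem_left _ γ' h0) (Ideal.mul_mem_left _ (γ' * (γ - 1)) hn2')
      convert this using 1
      linear_combination -(γ - 1) * hγγ
    · convert Ideal.mul_mem_left (nilradical Z) γ' h0 using 1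
      linear_combination -(γ - 1) * hγγ
  obtain ⟨N, hN⟩ := exists_pow_prime_pow_eq_one (R := R) (p := 2) (q := 1) (g := g)
    Nat.prime_two (by simp [not_isNilpotent_one]) (by simpa using mem_nilradical.1 hn2')
    (by simpa using mem_nilradical.1 hx)
  obtain ⟨k, -, hk⟩ := (Nat.dvd_prime_pow Nat.prime_two).1 (orderOf_dvd_of_pow_eq_one hN)
  exact ⟨k, hk⟩
end
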